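/- arXiv:2107.07070 — 2 statements merged into one kernel-verified Lean document; each statement's English description precedes it below -/
import Mathlib

section
/- Every classical stationary solution (U, N, P) of the damped Navier–Stokes–Bardina equations with force f satisfies the energy estimate β ( ‖U‖²_{L²} + α²‖U‖²_{Ḣ¹} ) + 2να² ‖U‖²_{Ḣ²} ≤ (1/β) ( ‖f‖²_{L²} + α²‖f‖²_{Ḣ¹} ); in particular ‖U‖²_{H¹_α} ≤ (1/β²) ‖f‖²_{H¹_α}. -/
open MeasureTheory Set

noncomputable section

abbrev V3 : Type := Fin 3 → ℝ

def pd (j : Fin 3) (g : V3 → Fin 3 → ℝ) : V3 → Fin 3 → ℝ :=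
  fun x => fderiv ℝ g x (Pi.single j 1)

def pdS (j : Fin 3) (g : V3 → ℝ) : V3 → ℝ :=
  fun x => fderiv ℝ g x (Pi.single j 1)

def L2sq (g : V3 → Fin 3 → ℝ) : ℝ := ∫ x : V3, ∑ i, (g x i)^2
def H1sq (g : V3 → Fin 3 → ℝ) : ℝ := ∫ x : V3, ∑ i, ∑ j, (pd j g x i)^2
def H2sq (g : V3 → Fin 3 → ℝ) : ℝ := ∫ x : V3, ∑ i, ∑ j, ∑ k, (pd k (pd j g) x i)^2
def H1aSq (α : ℝ) (g : V3 → Fin 3 → ℝ) : ℝ := L2sq g + α^2 * H1sq g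

def IsSchwartz {F : Type*} [NormedAddCommGroup F] [NormedSpace ℝ F] (g : V3 → F) : Prop :=
  ContDiff ℝ (⊤ : ℕ∞) g ∧ ∀ (k n : ℕ), ∃ C : ℝ, ∀ x : V3, ‖x‖ ^ k * ‖iteratedFDeriv ℝ n g x‖ ≤ C

def IsForce (f : V3 → Fin 3 → ℝ) : Prop :=
  IsSchwartz f ∧ ∀ x, (∑ j, pd j f x j) = 0

def SchwartzLocBdd {F : Type*} [NormedAddCommGroup F] [NormedSpace ℝ F]
    (g : ℝ → V3 → F) : Prop :=
  ContDiffOn ℝ (⊤ : ℕ∞) (fun q : ℝ × V3 => g q.1 q.2) (Set.Ici (0:ℝ) ×ˢ Set.univ) ∧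
  ∀ T > (0:ℝ), ∀ (k n : ℕ), ∃ C : ℝ, ∀ t ∈ Set.Icc (0:ℝ) T, ∀ x : V3,
    ‖x‖ ^ k * ‖iteratedFDeriv ℝ n (g t) x‖ ≤ C

structure ClassicalSolution (α β ν : ℝ) (u₀ f : V3 → Fin 3 → ℝ) where
  u : ℝ → V3 → Fin 3 → ℝ
  N : ℝ → V3 → Fin 3 → ℝ
  p : ℝ → V3 → ℝ
  reg_u : SchwartzLocBdd u
  reg_N : SchwartzLocBdd N
  reg_p : SchwartzLocBdd p
  divFree : ∀ t ≥ (0:ℝ), ∀ x, (∑ j, pd j (u t) x j) = 0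
  filter : ∀ t ≥ (0:ℝ), ∀ x i, -α^2 * (∑ j, pd j (pd j (N t)) x i) + N t x i
      = ∑ j, u t x j * pd j (u t) x i
  momentum : ∀ t ≥ (0:ℝ), ∀ x i,
      derivWithin (fun s => u s x i) (Set.Ici (0:ℝ)) t + N t x i
        - ν * (∑ j, pd j (pd j (u t)) x i) + pdS i (p t) x
      = f x i - β * u t x i
  init : ∀ x, u 0 x = u₀ x


structure StationarySolution (α β ν : ℝ) (f : V3 → Fin 3 → ℝ) where
  U : V3 → Fin 3 → ℝ
  N : V3 → Fin 3 → ℝ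
  P : V3 → ℝ
  schwartz_U : IsSchwartz U
  schwartz_N : IsSchwartz N
  schwartz_P : IsSchwartz P
  divFree : ∀ x, (∑ j, pd j U x j) = 0
  filter : ∀ x i, -α^2 * (∑ j, pd j (pd j N) x i) + N x i = ∑ j, U x j * pd j U x i
  momentum : ∀ x i, -ν * (∑ j, pd j (pd j U) x i) + N x i + pdS i P x
      = f x i - β * U x i

open scoped SchwartzMap LineDeriv

section SkewDerivations

/-! ### Commuting skew-adjoint operators on a bilinear form space -/

variable {ι E : Type*} [Fintype ι] [AddCommGroup E] [Module ℝ E]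
  {B : LinearMap.BilinForm ℝ E} {D : ι → E →ₗ[ℝ] E}

/-- The operator `v - a ∑ k, D k (D k v)`. -/
def helmholtz (D : ι → E →ₗ[ℝ] E) (a : ℝ) : E →ₗ[ℝ] E :=
  LinearMap.id - a • ∑ k, D k ∘ₗ D k

theorem helmholtz_apply (D : ι → E →ₗ[ℝ] E) (a : ℝ) (v : E) :
    helmholtz D a v = v - a • ∑ k, D k (D k v) := by
  simp [helmholtz]

theorem bilin_helmholtz_right (hD : ∀ j v w, B v (D j w) = -B (D j v) w) (a : ℝ) (v w : E) :
    B v (helmholtz D a w) = B v w + a * ∑ k, B (D k v) (D k w) := by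
  simp [helmholtz_apply, hD, sub_eq_add_neg]

theorem bilin_helmholtz_comm (hD : ∀ j v w, B v (D j w) = -B (D j v) w) (a : ℝ) (v w : E) :
    B v (helmholtz D a w) = B (helmholtz D a v) w := by
  simp [helmholtz_apply, hD]

/-- A gradient is orthogonal to the Helmholtz operator applied to a divergence-free field. -/
theorem sum_bilin_gradient_helmholtz_eq_zero
    (hD : ∀ j v w, B v (D j w) = -B (D j v) w) (hcomm : ∀ j k v, D j (D k v) = D k (D j v))
    (a : ℝ) (p : E) {u : ι → E} (hu : ∑ i, D i (u i) = 0) :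
    ∑ i, B (D i p) (helmholtz D a (u i)) = 0 := by
  have h (i : ι) : B (D i p) (helmholtz D a (u i)) = -B (helmholtz D a p) (D i (u i)) := by
    rw [bilin_helmholtz_comm hD, hD, neg_neg]
    congr 1
    simp [helmholtz_apply, fun k v => hcomm i k v]
  simp only [h, Finset.sum_neg_distrib]
  rw [← map_sum, hu, map_zero, neg_zero]

theorem bilin_laplacian_helmholtz
    (hD : ∀ j v w, B v (D j w) = -B (D j v) w) (hcomm : ∀ j k v, D j (D k v) = D k (D j v))
    (a : ℝ) (u : E) :
    B (∑ j, D j (D j u)) (helmholtz D a u) =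
      -∑ j, B (D j u) (D j u) - a * ∑ j, ∑ k, B (D k (D j u)) (D k (D j u)) := by
  have hD' (j : ι) (v w : E) : B (D j v) w = -B v (D j w) := by rw [hD, neg_neg]
  have h (j : ι) : B (D j (D j u)) (helmholtz D a u) =
      -B (D j u) (D j u) - a * ∑ k, B (D k (D j u)) (D k (D j u)) := by
    rw [bilin_helmholtz_right hD, hD']
    have hk (k : ι) : B (D k (D j (D j u))) (D k u) = -B (D k (D j u)) (D k (D j u)) := by
      rw [hcomm k j (D j u), hD', hcomm j k u]
    simp only [hk, Finset.sum_neg_distrib]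
    ring
  simp only [map_sum, LinearMap.sum_apply, h, Finset.sum_sub_distrib, Finset.sum_neg_distrib,
    Finset.mul_sum]

theorem two_mul_mul_bilin_le (hsymm : ∀ v w, B v w = B w v) (hpos : ∀ v, 0 ≤ B v v)
    {b : ℝ} (hb : 0 < b) (v w : E) : 2 * B v w ≤ 1 / b * B v v + b * B w w := by
  have h := hpos (v - b • w)
  simp only [map_sub, map_smul, LinearMap.sub_apply, LinearMap.smul_apply, smul_eq_mul,
    hsymm w v] at h
  have h2 : 0 ≤ 1 / b * (B v v - b * B v w - b * (B v w - b * B w w)) := by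
    apply mul_nonneg (by positivity)
    linarith
  have h3 : 1 / b * (B v v - b * B v w - b * (B v w - b * B w w)) =
      1 / b * B v v - 2 * B v w + b * B w w := by
    field_simp
    ring
  linarith

/-- The energy estimate for an equation `-ν ∑ k, D k (D k u) + n + D p + b u = f` in which the
filtered nonlinearity is orthogonal to `u`. -/
theorem energy_estimate_of_skew
    (hsymm : ∀ v w, B v w = B w v) (hpos : ∀ v, 0 ≤ B v v)
    (hD : ∀ j v w, B v (D j w) = -B (D j v) w) (hcomm : ∀ j k v, D j (D k v) = D k (D j v))
    {a b ν : ℝ} (ha : 0 ≤ a) (hb : 0 < b) (hν : 0 ≤ ν) {u n f : ι → E} {p : E}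
    (hdiv : ∑ i, D i (u i) = 0) (horth : ∑ i, B (helmholtz D a (n i)) (u i) = 0)
    (hmom : ∀ i, -ν • ∑ j, D j (D j (u i)) + n i + D i p = f i - b • u i) :
    b * (∑ i, B (u i) (u i) + a * ∑ i, ∑ j, B (D j (u i)) (D j (u i)))
        + 2 * ν * a * ∑ i, ∑ j, ∑ k, B (D k (D j (u i))) (D k (D j (u i)))
      ≤ 1 / b * (∑ i, B (f i) (f i) + a * ∑ i, ∑ j, B (D j (f i)) (D j (f i))) := by
  have htest (i : ι) := congrArg (fun v => B v (helmholtz D a (u i))) (hmom i)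
  simp only [map_add, map_sub, map_smul, LinearMap.add_apply, LinearMap.sub_apply,
    LinearMap.smul_apply, smul_eq_mul, bilin_laplacian_helmholtz hD hcomm,
    bilin_helmholtz_comm hD a (n _), bilin_helmholtz_right hD a (f _),
    bilin_helmholtz_right hD a (u _)] at htest
  have hsum := Finset.sum_congr (rfl : Finset.univ = Finset.univ) fun i _ => htest i
  simp only [Finset.sum_add_distrib, Finset.sum_sub_distrib, ← Finset.mul_sum,
    Finset.sum_neg_distrib, horth, sum_bilin_gradient_helmholtz_eq_zero hD hcomm a p hdiv,
    add_zero] at hsum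
  have h₀ := Finset.sum_le_sum fun i (_ : i ∈ Finset.univ) =>
    two_mul_mul_bilin_le hsymm hpos hb (f i) (u i)
  have h₁ := Finset.sum_le_sum fun i (_ : i ∈ Finset.univ) =>
    Finset.sum_le_sum fun j (_ : j ∈ Finset.univ) =>
      two_mul_mul_bilin_le hsymm hpos hb (D j (f i)) (D j (u i))
  simp only [Finset.sum_add_distrib, ← Finset.mul_sum] at h₀ h₁
  have h₁a := mul_le_mul_of_nonneg_left h₁ ha
  have hgrad : 0 ≤ ν * ∑ i, ∑ j, B (D j (u i)) (D j (u i)) :=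
    mul_nonneg hν (Finset.sum_nonneg fun i _ => Finset.sum_nonneg fun j _ => hpos _)
  linarith

end SkewDerivations

section ScalarSchwartz

/-! ### Scalar Schwartz functions on `V3` -/

/-- The `L²` inner product of real Schwartz functions. -/
def schwartzInner : LinearMap.BilinForm ℝ 𝓢(V3, ℝ) :=
  LinearMap.mk₂ ℝ (fun v w => ∫ x, SchwartzMap.pairing (ContinuousLinearMap.mul ℝ ℝ) v w x)
    (fun v v' w => by
      rw [map_add, ← integral_add (SchwartzMap.integrable _) (SchwartzMap.integrable _)]
      rfl)
    (fun c v w => by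
      rw [map_smul, ← integral_smul]
      rfl)
    (fun v w w' => by
      rw [map_add, ← integral_add (SchwartzMap.integrable _) (SchwartzMap.integrable _)]
      rfl)
    (fun c v w => by
      rw [map_smul, ← integral_smul]
      rfl)

theorem schwartzInner_apply (v w : 𝓢(V3, ℝ)) : schwartzInner v w = ∫ x, v x * w x := rfl

theorem integrable_schwartz_mul (v w : 𝓢(V3, ℝ)) : Integrable fun x => v x * w x :=
  (SchwartzMap.pairing (ContinuousLinearMap.mul ℝ ℝ) v w).integrable

/-- The `j`-th partial derivative on real Schwartz functions. -/
def schwartzPartial (j : Fin 3) : 𝓢(V3, ℝ) →ₗ[ℝ] 𝓢(V3, ℝ) :=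
  (LineDeriv.lineDerivOpCLM ℝ 𝓢(V3, ℝ) (Pi.single j 1 : V3)).toLinearMap

theorem schwartzPartial_apply (j : Fin 3) (v : 𝓢(V3, ℝ)) (x : V3) :
    schwartzPartial j v x = fderiv ℝ v x (Pi.single j 1) := rfl

theorem schwartzInner_comm (v w : 𝓢(V3, ℝ)) : schwartzInner v w = schwartzInner w v := by
  simp only [schwartzInner_apply, mul_comm]

theorem schwartzInner_self_nonneg (v : 𝓢(V3, ℝ)) : 0 ≤ schwartzInner v v :=
  integral_nonneg fun x => mul_self_nonneg (v x)

theorem schwartzInner_partial_right (j : Fin 3) (v w : 𝓢(V3, ℝ)) :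
    schwartzInner v (schwartzPartial j w) = -schwartzInner (schwartzPartial j v) w :=
  SchwartzMap.integral_mul_lineDerivOp_right_eq_neg_left v w _

theorem schwartzPartial_comm (j k : Fin 3) (v : 𝓢(V3, ℝ)) :
    schwartzPartial j (schwartzPartial k v) = schwartzPartial k (schwartzPartial j v) := by
  have hsecond (j k : Fin 3) (x : V3) : schwartzPartial j (schwartzPartial k v) x =
      fderiv ℝ (fderiv ℝ v) x (Pi.single j 1) (Pi.single k 1) := by
    have hd : DifferentiableAt ℝ (fderiv ℝ v) x :=
      ((v.smooth 2).fderiv_right (m := 1) (by norm_num)).differentiable (by norm_num) x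
    have hfun : ⇑(schwartzPartial k v) = fun y => fderiv ℝ v y (Pi.single k 1) := rfl
    rw [schwartzPartial_apply, hfun, fderiv_clm_apply hd (differentiableAt_const _)]
    simp
  ext x
  rw [hsecond, hsecond]
  exact ((v.smooth 2).contDiffAt.isSymmSndFDerivAt (by simp)).eq _ _

/-- The convective term of a divergence-free field is orthogonal to the field. -/
theorem sum_schwartzInner_convection_eq_zero {u c : Fin 3 → 𝓢(V3, ℝ)}
    (hdiv : ∑ j, schwartzPartial j (u j) = 0)
    (hc : ∀ i x, c i x = ∑ j, u j x * schwartzPartial j (u i) x) :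
    ∑ i, schwartzInner (c i) (u i) = 0 := by
  let m (v w : 𝓢(V3, ℝ)) : 𝓢(V3, ℝ) := SchwartzMap.pairing (ContinuousLinearMap.mul ℝ ℝ) v w
  have hm (v w : 𝓢(V3, ℝ)) (x : V3) : m v w x = v x * w x := rfl
  have hleibniz (j : Fin 3) (v w : 𝓢(V3, ℝ)) (x : V3) : schwartzPartial j (m v w) x =
      v x * schwartzPartial j w x + schwartzPartial j v x * w x := by
    have hfun : ⇑(m v w) = fun y => v y * w y := rfl
    rw [schwartzPartial_apply, hfun, fderiv_fun_mul v.differentiableAt w.differentiableAt]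
    simp [schwartzPartial_apply, mul_comm]
  have hparts (i j : Fin 3) : 2 * schwartzInner (m (u j) (schwartzPartial j (u i))) (u i) =
      -schwartzInner (schwartzPartial j (u j)) (m (u i) (u i)) := by
    rw [← schwartzInner_partial_right]
    simp only [schwartzInner_apply, ← integral_const_mul, hleibniz, hm]
    congr 1 with x
    ring
  have hci (i : Fin 3) : c i = ∑ j, m (u j) (schwartzPartial j (u i)) := by
    ext x
    simp [hc, hm]
  have htwo (i : Fin 3) : 2 * schwartzInner (c i) (u i) = 0 := by
    rw [hci, map_sum, LinearMap.sum_apply, Finset.mul_sum]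
    simp only [hparts]
    rw [Finset.sum_neg_distrib, ← LinearMap.sum_apply, ← map_sum, hdiv]
    simp
  exact Finset.sum_eq_zero fun i _ => by linarith [htwo i]

theorem IsSchwartz.exists_components {g : V3 → Fin 3 → ℝ} (hg : IsSchwartz g) :
    ∃ s : Fin 3 → 𝓢(V3, ℝ), g = fun x i => s i x := by
  let G : 𝓢(V3, Fin 3 → ℝ) := ⟨g, hg.1, hg.2⟩
  exact ⟨fun i => SchwartzMap.postcompCLM (ContinuousLinearMap.proj (R := ℝ) i) G, rfl⟩

theorem pd_components (j : Fin 3) (s : Fin 3 → 𝓢(V3, ℝ)) :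
    pd j (fun x i => s i x) = fun x i => schwartzPartial j (s i) x := by
  funext x i
  rw [pd, fderiv_pi fun i => (s i).differentiableAt]
  rfl

theorem L2sq_components (s : Fin 3 → 𝓢(V3, ℝ)) :
    L2sq (fun x i => s i x) = ∑ i, schwartzInner (s i) (s i) := by
  simp only [L2sq, schwartzInner_apply, sq]
  exact integral_finsetSum _ fun i _ => integrable_schwartz_mul _ _

theorem H1sq_components (s : Fin 3 → 𝓢(V3, ℝ)) :
    H1sq (fun x i => s i x) =
      ∑ i, ∑ j, schwartzInner (schwartzPartial j (s i)) (schwartzPartial j (s i)) := by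
  simp only [H1sq, pd_components, schwartzInner_apply, sq]
  rw [integral_finsetSum _ fun i _ => integrable_finsetSum _ fun j _ => integrable_schwartz_mul _ _]
  exact Finset.sum_congr rfl fun i _ =>
    integral_finsetSum _ fun j _ => integrable_schwartz_mul _ _

theorem H2sq_components (s : Fin 3 → 𝓢(V3, ℝ)) :
    H2sq (fun x i => s i x) = ∑ i, ∑ j, ∑ k,
      schwartzInner (schwartzPartial k (schwartzPartial j (s i)))
        (schwartzPartial k (schwartzPartial j (s i))) := by
  simp only [H2sq, pd_components, schwartzInner_apply, sq]
  rw [integral_finsetSum _ fun i _ => integrable_finsetSum _ fun j _ =>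
    integrable_finsetSum _ fun k _ => integrable_schwartz_mul _ _]
  refine Finset.sum_congr rfl fun i _ => ?_
  rw [integral_finsetSum _ fun j _ => integrable_finsetSum _ fun k _ =>
    integrable_schwartz_mul _ _]
  exact Finset.sum_congr rfl fun j _ =>
    integral_finsetSum _ fun k _ => integrable_schwartz_mul _ _

end ScalarSchwartz

/-- Energy estimate for stationary solutions. -/
theorem stationary_energy_estimate (α β ν : ℝ) (hα : 0 < α) (hβ : 0 < β) (hν : 0 < ν)
    (f : V3 → Fin 3 → ℝ) (hf : IsForce f)
    (S : StationarySolution α β ν f) :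
    β * (L2sq S.U + α^2 * H1sq S.U) + 2 * ν * α^2 * H2sq S.U
      ≤ 1 / β * (L2sq f + α^2 * H1sq f)
    ∧ H1aSq α S.U ≤ 1 / β^2 * H1aSq α f := by
  obtain ⟨U, N, P, hU, hN, hP, hdiv, hfilter, hmom⟩ := S
  obtain ⟨u, rfl⟩ := hU.exists_components
  obtain ⟨n, rfl⟩ := hN.exists_components
  obtain ⟨F, rfl⟩ := hf.1.exists_components
  obtain ⟨p, rfl⟩ : ∃ p : 𝓢(V3, ℝ), P = p := ⟨⟨P, hP.1, hP.2⟩, rfl⟩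
  simp only [pd_components] at hdiv hfilter hmom
  have hdiv' : ∑ j, schwartzPartial j (u j) = 0 := by
    ext x
    simpa using hdiv x
  have horth : ∑ i, schwartzInner (helmholtz schwartzPartial (α ^ 2) (n i)) (u i) = 0 := by
    refine sum_schwartzInner_convection_eq_zero hdiv' fun i x => ?_
    rw [← hfilter x i]
    simp [helmholtz_apply]
    ring
  have hmom' (i : Fin 3) : -ν • ∑ j, schwartzPartial j (schwartzPartial j (u i)) + n i
      + schwartzPartial i p = F i - β • u i := by
    ext x
    simpa [schwartzPartial_apply, pdS] using hmom x i
  have hmain : β * (L2sq (fun x i => u i x) + α ^ 2 * H1sq (fun x i => u i x))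
      + 2 * ν * α ^ 2 * H2sq (fun x i => u i x)
      ≤ 1 / β * (L2sq (fun x i => F i x) + α ^ 2 * H1sq (fun x i => F i x)) := by
    rw [L2sq_components, H1sq_components, H2sq_components, L2sq_components, H1sq_components]
    exact energy_estimate_of_skew schwartzInner_comm schwartzInner_self_nonneg
      schwartzInner_partial_right schwartzPartial_comm (sq_nonneg α) hβ hν.le hdiv' horth hmom'
  refine ⟨hmain, ?_⟩
  have hH2 : 0 ≤ 2 * ν * α ^ 2 * H2sq (fun x i => u i x) :=
    mul_nonneg (by positivity) (integral_nonneg fun x => Finset.sum_nonneg fun i _ =>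
      Finset.sum_nonneg fun j _ => Finset.sum_nonneg fun k _ => sq_nonneg _)
  simp only [H1aSq]
  calc _ = 1 / β * (β * (L2sq (fun x i => u i x) + α ^ 2 * H1sq (fun x i => u i x))) := by
        field_simp
    _ ≤ 1 / β * (1 / β * (L2sq (fun x i => F i x) + α ^ 2 * H1sq (fun x i => F i x))) :=
        mul_le_mul_of_nonneg_left (by linarith) (by positivity)
    _ = _ := by
        field_simp

end
end

section
/- There exists an absolute constant c > 0 with the following property. Let f₁, f₂ be forces and, for i = 1, 2, let (uᵢ, Nᵢ, pᵢ) be a classical solution of the damped Navier–Stokes–Bardina equations with initial datum u_{0,i} and force fᵢ. Assume ‖u_{0,1}‖_{H¹_α} ≤ (√8/β) ‖f₁‖_{H¹_α}, and set η = −β + (c/(α^{5/2} β)) ‖f₁‖_{H¹_α}. Then for all t ≥ 0: ‖u₁(t,·) − u₂(t,·)‖²_{H¹_α} ≤ ‖u_{0,1} − u_{0,2}‖²_{H¹_α} e^{ηt} + (1/β) ‖f₁ − f₂‖²_{H¹_α} ∫₀ᵗ e^{η(t−s)} ds. -/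
open MeasureTheory Set

noncomputable section

open SchwartzMap LineDeriv

/-- The partial derivative in direction `j` as an operator on scalar Schwartz functions. -/
def sd (j : Fin 3) : 𝓢(V3, ℝ) →L[ℝ] 𝓢(V3, ℝ) :=
  lineDerivOpCLM ℝ 𝓢(V3, ℝ) (Pi.single j 1 : V3)

theorem sd_apply (j : Fin 3) (f : 𝓢(V3, ℝ)) (x : V3) :
    sd j f x = fderiv ℝ f x (Pi.single j 1) := rfl

theorem sd_comm (i j : Fin 3) (f : 𝓢(V3, ℝ)) : sd i (sd j f) = sd j (sd i f) := by
  ext x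
  have key : ∀ (i j : Fin 3), sd i (sd j f) x
      = fderiv ℝ (fderiv ℝ f) x (Pi.single i 1) (Pi.single j 1) := by
    intro i j
    have hd : DifferentiableAt ℝ (fderiv ℝ f) x :=
      (((f.smooth 2).fderiv_right (m := 1) (by norm_num)).differentiable (by norm_num)) x
    rw [sd_apply, show (⇑(sd j f) : V3 → ℝ) = fun y => fderiv ℝ f y (Pi.single j 1) from rfl,
      fderiv_clm_apply hd (by fun_prop)]
    simp
  rw [key, key]
  exact ((f.smooth 2).contDiffAt.isSymmSndFDerivAt (by simp)).eq _ _

/-- Pointwise product of Schwartz functions. -/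
def pmul (f g : 𝓢(V3, ℝ)) : 𝓢(V3, ℝ) := pairing (ContinuousLinearMap.mul ℝ ℝ) f g

theorem pmul_apply (f g : 𝓢(V3, ℝ)) (x : V3) : pmul f g x = f x * g x := rfl

theorem integrable_mul (f g : 𝓢(V3, ℝ)) : Integrable (fun x => f x * g x) :=
  (pmul f g).integrable

theorem sd_pmul (j : Fin 3) (f g : 𝓢(V3, ℝ)) :
    sd j (pmul f g) = pmul (sd j f) g + pmul f (sd j g) := by
  ext x
  rw [sd_apply, show (⇑(pmul f g) : V3 → ℝ) = fun y => f y * g y from rfl,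
    fderiv_fun_mul f.differentiableAt g.differentiableAt]
  simp [pmul_apply, sd_apply]
  ring

/-- The `L²` pairing as a bilinear form on Schwartz functions. -/
def ip : 𝓢(V3, ℝ) →ₗ[ℝ] 𝓢(V3, ℝ) →ₗ[ℝ] ℝ :=
  LinearMap.mk₂ ℝ (fun f g => ∫ x, f x * g x)
    (fun f g h => by
      rw [← integral_add (integrable_mul _ _) (integrable_mul _ _)]
      exact integral_congr_ae (.of_forall fun x => by simp [add_mul]))
    (fun c f g => by
      rw [smul_eq_mul, ← integral_const_mul]
      exact integral_congr_ae (.of_forall fun x => by simp [mul_assoc]))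
    (fun f g h => by
      rw [← integral_add (integrable_mul _ _) (integrable_mul _ _)]
      exact integral_congr_ae (.of_forall fun x => by simp [mul_add]))
    (fun c f g => by
      rw [smul_eq_mul, ← integral_const_mul]
      exact integral_congr_ae (.of_forall fun x => by simp [mul_left_comm]))

theorem ip_apply (f g : 𝓢(V3, ℝ)) : ip f g = ∫ x, f x * g x := rfl

theorem ip_comm (f g : 𝓢(V3, ℝ)) : ip f g = ip g f := by
  simp only [ip_apply, mul_comm]

theorem ip_self_nonneg (f : 𝓢(V3, ℝ)) : 0 ≤ ip f f :=
  integral_nonneg fun x => mul_self_nonneg (f x)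

theorem ip_sd (j : Fin 3) (f g : 𝓢(V3, ℝ)) : ip f (sd j g) = -ip (sd j f) g :=
  integral_mul_lineDerivOp_right_eq_neg_left f g _

theorem ip_sq_le (f g : 𝓢(V3, ℝ)) : ip f g ^ 2 ≤ ip f f * ip g g := by
  have h : ∀ s : ℝ, 0 ≤ ip g g * (s * s) + 2 * ip f g * s + ip f f := fun s => by
    have := ip_self_nonneg (f + s • g)
    simp only [map_add, map_smul, LinearMap.add_apply, LinearMap.smul_apply, smul_eq_mul,
      ip_comm g f] at this
    linarith
  have := discrim_le_zero h
  rw [discrim] at this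
  linarith

/-- The operator `1 - α²Δ`. -/
def helm (α : ℝ) : 𝓢(V3, ℝ) →L[ℝ] 𝓢(V3, ℝ) :=
  ContinuousLinearMap.id ℝ _ - (α ^ 2) • ∑ j, (sd j).comp (sd j)

theorem helm_apply (α : ℝ) (f : 𝓢(V3, ℝ)) :
    helm α f = f - (α ^ 2) • ∑ j, sd j (sd j f) := by
  simp [helm]

/-- The `H¹_α` inner product of scalar Schwartz functions. -/
def hip (α : ℝ) (f g : 𝓢(V3, ℝ)) : ℝ := ip f g + α ^ 2 * ∑ j, ip (sd j f) (sd j g)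

theorem hip_self_nonneg (α : ℝ) (f : 𝓢(V3, ℝ)) : 0 ≤ hip α f f :=
  add_nonneg (ip_self_nonneg f)
    (mul_nonneg (sq_nonneg α) (Finset.sum_nonneg fun _ _ => ip_self_nonneg _))

theorem ip_helm (α : ℝ) (f g : 𝓢(V3, ℝ)) : ip f (helm α g) = hip α f g := by
  simp only [helm_apply, hip, map_sub, map_smul, map_sum, ip_sd, smul_eq_mul,
    Finset.sum_neg_distrib]
  ring

theorem hip_comm (α : ℝ) (f g : 𝓢(V3, ℝ)) : hip α f g = hip α g f := by
  simp only [hip, ip_comm f g, fun j => ip_comm (sd j f) (sd j g)]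

theorem hip_le (α : ℝ) {β : ℝ} (hβ : 0 < β) (f w : 𝓢(V3, ℝ)) :
    2 * hip α f w ≤ 1 / β * hip α f f + β * hip α w w := by
  have h := hip_self_nonneg α (f - β • w)
  have e : hip α (f - β • w) (f - β • w)
      = hip α f f - 2 * β * hip α f w + β ^ 2 * hip α w w := by
    simp only [← ip_helm, map_sub, map_smul, LinearMap.sub_apply, LinearMap.smul_apply,
      smul_eq_mul]
    simp only [ip_helm, hip_comm α w f]
    ring
  rw [e] at h
  have h2 := mul_nonneg (one_div_nonneg.2 hβ.le) h
  have e2 : 1 / β * (hip α f f - 2 * β * hip α f w + β ^ 2 * hip α w w)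
      = 1 / β * hip α f f - 2 * hip α f w + β * hip α w w := by
    field_simp
  linarith

theorem ip_lap_helm_nonpos (α : ℝ) (w : 𝓢(V3, ℝ)) :
    ip (∑ j, sd j (sd j w)) (helm α w) ≤ 0 := by
  rw [helm_apply, map_sub, map_smul, smul_eq_mul]
  have h1 : ip (∑ j, sd j (sd j w)) w = -∑ j, ip (sd j w) (sd j w) := by
    simp only [map_sum, LinearMap.sum_apply, ip_sd, Finset.sum_neg_distrib, neg_neg]
  have h2 : 0 ≤ ∑ j, ip (sd j w) (sd j w) := Finset.sum_nonneg fun j _ => ip_self_nonneg _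
  have h3 := mul_nonneg (sq_nonneg α) (ip_self_nonneg (∑ j, sd j (sd j w)))
  linarith

theorem sum_ip_grad_helm (α : ℝ) (q : 𝓢(V3, ℝ)) (w : Fin 3 → 𝓢(V3, ℝ))
    (hw : ∑ i, sd i (w i) = 0) : ∑ i, ip (sd i q) (helm α (w i)) = 0 := by
  have h : ∀ i, ip (sd i q) (helm α (w i)) = -ip q (helm α (sd i (w i))) := fun i => by
    have : helm α (sd i (w i)) = sd i (helm α (w i)) := by
      simp only [helm_apply, map_sub, map_smul, map_sum, sd_comm i]
    rw [this, ip_sd, neg_neg]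
  simp only [h, Finset.sum_neg_distrib, ← map_sum, hw, map_zero, neg_zero]

theorem sum_ip_transport (b : Fin 3 → 𝓢(V3, ℝ)) (w : 𝓢(V3, ℝ))
    (hb : ∑ j, sd j (b j) = 0) : ∑ j, ip (pmul (b j) (sd j w)) w = 0 := by
  have h : ∀ j, 2 * ip (pmul (b j) (sd j w)) w = -ip (sd j (b j)) (pmul w w) := fun j => by
    have h1 : ip (pmul (b j) (sd j w)) w = ip (pmul (b j) w) (sd j w) :=
      integral_congr_ae (.of_forall fun x => by simp only [pmul_apply]; ring)
    have h2 : ip (pmul (sd j (b j)) w) w = ip (sd j (b j)) (pmul w w) :=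
      integral_congr_ae (.of_forall fun x => by simp only [pmul_apply]; ring)
    have h3 := ip_sd j (pmul (b j) w) w
    rw [sd_pmul, map_add, LinearMap.add_apply, h2] at h3
    linarith
  have : 2 * ∑ j, ip (pmul (b j) (sd j w)) w = 0 := by
    rw [Finset.mul_sum]
    simp only [h, Finset.sum_neg_distrib, ← LinearMap.sum_apply, ← map_sum, hb, map_zero,
      LinearMap.zero_apply, neg_zero]
  linarith

/-- The production term `∫ (w · ∇)a · w`. -/
def prodTerm (w a : Fin 3 → 𝓢(V3, ℝ)) : ℝ := ∑ i, ∑ j, ip (pmul (w j) (sd j (a i))) (w i)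

/-- The right-hand side of the energy balance of the linearised equation. -/
theorem energy_balance_le {α β ν : ℝ} (hβ : 0 < β) (hν : 0 < ν)
    (w M F a b d : Fin 3 → 𝓢(V3, ℝ)) (q : 𝓢(V3, ℝ))
    (hw : ∑ i, sd i (w i) = 0) (hb : ∑ i, sd i (b i) = 0)
    (hM : ∀ i, helm α (M i) = ∑ j, (pmul (w j) (sd j (a i)) + pmul (b j) (sd j (w i))))
    (hd : ∀ i, d i = F i - β • w i - M i + ν • (∑ j, sd j (sd j (w i))) - sd i q) :
    2 * ∑ i, ip (d i) (helm α (w i))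
      ≤ -β * ∑ i, hip α (w i) (w i) + 1 / β * ∑ i, hip α (F i) (F i) - 2 * prodTerm w a := by
  have h1 : ∀ i, ip (d i) (helm α (w i)) = hip α (F i) (w i) - β * hip α (w i) (w i)
      - ∑ j, ip (pmul (w j) (sd j (a i))) (w i)
      + ν * ip (∑ j, sd j (sd j (w i))) (helm α (w i)) - ip (sd i q) (helm α (w i)) := fun i => by
    have hMi : ip (M i) (helm α (w i)) = ∑ j, ip (pmul (w j) (sd j (a i))) (w i) := by
      rw [ip_helm, hip_comm, ← ip_helm, hM, ip_comm, Finset.sum_add_distrib, map_add,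
        LinearMap.add_apply, map_sum, map_sum, LinearMap.sum_apply, LinearMap.sum_apply,
        sum_ip_transport b (w i) hb, add_zero]
    rw [hd]
    simp only [map_sub, map_add, map_smul, LinearMap.sub_apply, LinearMap.add_apply,
      LinearMap.smul_apply, smul_eq_mul]
    rw [hMi, ip_helm, ip_helm]
  have h2 : ∀ i, 2 * ip (d i) (helm α (w i)) ≤ 1 / β * hip α (F i) (F i)
      - β * hip α (w i) (w i) - 2 * ∑ j, ip (pmul (w j) (sd j (a i))) (w i)
      - 2 * ip (sd i q) (helm α (w i)) := fun i => by
    have h3 := hip_le α hβ (F i) (w i)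
    have h4 := mul_nonpos_of_nonneg_of_nonpos hν.le (ip_lap_helm_nonpos α (w i))
    rw [h1]
    linarith
  have h5 := Finset.sum_le_sum fun i (_ : i ∈ Finset.univ) => h2 i
  simp only [Finset.sum_sub_distrib, ← Finset.mul_sum, sum_ip_grad_helm α q w hw] at h5
  rw [prodTerm]
  linarith
open Filter Topology ENNReal

theorem eLpNorm_six_le (f : 𝓢(V3, ℝ)) :
    eLpNorm f 6 volume ≤ eLpNormLESNormFDerivOfEqInnerConst (volume : Measure V3) (2 : NNReal)
      * eLpNorm (fderiv ℝ f) 2 volume := by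
  set C := eLpNormLESNormFDerivOfEqInnerConst (volume : Measure V3) (2 : NNReal)
  let χ : ContDiffBump (0 : V3) := ⟨1, 2, one_pos, one_lt_two⟩
  have hχs : ContDiff ℝ 1 χ := χ.contDiff
  obtain ⟨B, hB⟩ := (χ.hasCompactSupport.fderiv (𝕜 := ℝ)).exists_bound_of_continuous
    (hχs.continuous_fderiv one_ne_zero)
  have hB0 : 0 ≤ B := (norm_nonneg _).trans (hB 0)
  let r : ℕ → ℝ := fun n => ((n : ℝ) + 1)⁻¹
  have hr : ∀ n, 0 < r n := fun n => by positivity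
  have hr0 : Tendsto r atTop (𝓝 0) := tendsto_inv_atTop_zero.comp
    (tendsto_atTop_add_const_right _ _ tendsto_natCast_atTop_atTop)
  let ψ : ℕ → V3 → ℝ := fun n x => χ (r n • x)
  have hψd : ∀ n x, HasFDerivAt (ψ n) (r n • fderiv ℝ χ (r n • x)) x := fun n x => by
    have h1 := (hχs.differentiable one_ne_zero (r n • x)).hasFDerivAt
    have h2 : HasFDerivAt (fun y : V3 => r n • y) (r n • ContinuousLinearMap.id ℝ V3) x :=
      (hasFDerivAt_id x).const_smul (r n)
    have h3 := h1.comp x h2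
    simpa [Function.comp_def, ψ] using h3
  have hψc : ∀ n, ContDiff ℝ 1 (ψ n) := fun n => hχs.comp (contDiff_const_smul (r n))
  let v : ℕ → V3 → ℝ := fun n x => ψ n x * f x
  have hv : ∀ n, ContDiff ℝ 1 (v n) := fun n => (hψc n).mul (f.smooth 1)
  have hvs : ∀ n, HasCompactSupport (v n) := fun n =>
    HasCompactSupport.mul_right
      (χ.hasCompactSupport.comp_homeomorph (Homeomorph.smulOfNeZero (r n) (hr n).ne'))
  have hvd : ∀ n x, ‖fderiv ℝ (v n) x‖ ≤ ‖(‖fderiv ℝ f x‖ + (r n * B) * ‖f x‖)‖ := fun n x => by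
    have h1 : fderiv ℝ (v n) x = ψ n x • fderiv ℝ f x + f x • (r n • fderiv ℝ χ (r n • x)) :=
      ((hψd n x).mul (f.hasFDerivAt x)).fderiv
    rw [h1, Real.norm_of_nonneg (by have := hr n; positivity)]
    refine (norm_add_le _ _).trans (add_le_add ?_ ?_)
    · rw [norm_smul]
      refine mul_le_of_le_one_left (norm_nonneg _) ?_
      rw [Real.norm_of_nonneg χ.nonneg]
      exact χ.le_one
    · rw [norm_smul, norm_smul, Real.norm_of_nonneg (hr n).le, mul_comm]
      gcongr
      exact hB _
  have hfd : MemLp (fderiv ℝ f) 2 (volume : Measure V3) :=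
    (fderivCLM ℝ V3 ℝ f).memLp 2 volume
  have hbound : ∀ n, eLpNorm (v n) 6 volume
      ≤ C * (eLpNorm (fderiv ℝ f) 2 volume + ENNReal.ofReal (r n * B) * eLpNorm f 2 volume) := by
    intro n
    have h1 : eLpNorm (v n) (6 : NNReal) volume ≤ C * eLpNorm (fderiv ℝ (v n)) (2 : NNReal) volume :=
      eLpNorm_le_eLpNorm_fderiv_of_eq_inner volume (hv n) (hvs n) (by norm_num) (by simp)
        (by simp; norm_num)
    refine (h1.trans ?_)
    gcongr
    refine (eLpNorm_mono (hvd n)).trans ?_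
    refine (eLpNorm_add_le hfd.1.norm ?_ (by norm_num)).trans ?_
    · exact (f.continuous.norm.aestronglyMeasurable).const_mul _
    · refine add_le_add ?_ ?_
      · simp
      · have := eLpNorm_const_smul (r n * B) (fun x => ‖f x‖) (2 : ℝ≥0∞) (volume : Measure V3)
        rw [show (fun x => r n * B * ‖f x‖) = (r n * B) • fun x => ‖f x‖ from rfl]
        simp only [ENNReal.coe_ofNat]
        rw [this, eLpNorm_norm, ← ofReal_norm, Real.norm_of_nonneg (by have := hr n; positivity)]
  have hlim : ∀ᵐ x ∂(volume : Measure V3), Tendsto (fun n => v n x) atTop (𝓝 (f x)) := by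
    refine .of_forall fun x => ?_
    have h1 : Tendsto (fun n => r n • x) atTop (𝓝 0) := by simpa using hr0.smul_const x
    have h2 : Tendsto (fun n => v n x) atTop (𝓝 (χ 0 * f x)) :=
      ((χ.continuous.tendsto 0).comp h1).mul_const _
    have h3 : χ (0 : V3) = 1 := χ.one_of_mem_closedBall (by simp [χ.rIn_pos.le])
    simpa [h3] using h2
  refine (Lp.eLpNorm_lim_le_liminf_eLpNorm
    (fun n => (hv n).continuous.aestronglyMeasurable) f hlim).trans ?_
  suffices hR : Tendsto (fun n => (C : ℝ≥0∞) * (eLpNorm (fderiv ℝ f) 2 volume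
      + ENNReal.ofReal (r n * B) * eLpNorm f 2 volume)) atTop
      (𝓝 (C * eLpNorm (fderiv ℝ f) 2 volume)) from
    (liminf_le_liminf (.of_forall hbound)).trans hR.liminf_eq.le
  have h0 : Tendsto (fun n => ENNReal.ofReal (r n * B) * eLpNorm f 2 volume) atTop (𝓝 0) := by
    have h1 : Tendsto (fun n => ENNReal.ofReal (r n * B)) atTop (𝓝 0) := by
      simpa using ENNReal.tendsto_ofReal (hr0.mul_const B)
    have hf2 : eLpNorm f 2 (volume : Measure V3) ≠ ∞ := (f.memLp 2 volume).2.ne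
    rw [← zero_mul (eLpNorm f 2 (volume : Measure V3))]
    exact ENNReal.Tendsto.mul_const h1 (Or.inr hf2)
  have h1 := (tendsto_const_nhds (x := eLpNorm (fderiv ℝ f) 2 (volume : Measure V3))).add h0
  rw [add_zero] at h1
  exact ENNReal.Tendsto.const_mul h1 (Or.inr ENNReal.coe_ne_top)

theorem norm_sq_le_sum_single (L : V3 →L[ℝ] ℝ) : ‖L‖ ^ 2 ≤ 3 * ∑ j, L (Pi.single j 1) ^ 2 := by
  have h : ‖L‖ ≤ ∑ j, |L (Pi.single j 1)| := by
    refine L.opNorm_le_bound (Finset.sum_nonneg fun j _ => abs_nonneg _) fun x => ?_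
    have hx : L x = ∑ j, x j * L (Pi.single j 1) := by
      conv_lhs => rw [← Finset.univ_sum_single x, map_sum]
      refine Finset.sum_congr rfl fun j _ => ?_
      rw [← smul_eq_mul, ← map_smul, ← Pi.single_smul, smul_eq_mul, mul_one]
    rw [hx, Finset.sum_mul]
    refine (norm_sum_le _ _).trans (Finset.sum_le_sum fun j _ => ?_)
    rw [norm_mul, mul_comm, Real.norm_eq_abs (L _)]
    exact mul_le_mul_of_nonneg_left (norm_le_pi_norm x j) (abs_nonneg _)
  refine (pow_le_pow_left₀ (norm_nonneg _) h 2).trans ?_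
  have := sq_sum_le_card_mul_sum_sq (s := Finset.univ) (f := fun j : Fin 3 => |L (Pi.single j 1)|)
  simpa using this

/-- Sobolev's inequality `Ḣ¹ ⊂ L⁶` for Schwartz functions, in integral form. -/
theorem exists_integral_pow_six_le : ∃ κ : ℝ, 0 < κ ∧ ∀ f : 𝓢(V3, ℝ),
    ∫ x, f x ^ 6 ≤ κ ^ 6 * (∑ j, ip (sd j f) (sd j f)) ^ 3 := by
  set C := eLpNormLESNormFDerivOfEqInnerConst (volume : Measure V3) (2 : NNReal)
  refine ⟨2 * (C + 1), by positivity, fun f => ?_⟩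
  have hfd : MemLp (fderiv ℝ f) 2 (volume : Measure V3) :=
    (fderivCLM ℝ V3 ℝ f).memLp 2 volume
  have h := ENNReal.toReal_mono (ENNReal.mul_ne_top ENNReal.coe_ne_top hfd.2.ne) (eLpNorm_six_le f)
  rw [ENNReal.toReal_mul, ENNReal.coe_toReal] at h
  set a := (eLpNorm f 6 volume).toReal
  set b := (eLpNorm (fderiv ℝ f) 2 volume).toReal
  have ha : ∫ x, f x ^ 6 = a ^ 6 := by
    have h1 := (f.memLp 6).eLpNorm_eq_integral_rpow_norm (by norm_num) (by norm_num)
    have h2 : 0 ≤ ∫ x, f x ^ 6 := integral_nonneg fun x => by positivity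
    have h3 : ∀ x, ‖f x‖ ^ (6 : ℝ) = f x ^ 6 := fun x => by
      rw [show (6 : ℝ) = (6 : ℕ) by norm_num, Real.rpow_natCast, Real.norm_eq_abs,
        Even.pow_abs (by decide)]
    simp only [ENNReal.toReal_ofNat, h3] at h1
    have h4 : a = (∫ x, f x ^ 6) ^ (6 : ℝ)⁻¹ := by
      simp only [a]
      rw [h1, ENNReal.toReal_ofReal (by positivity)]
    rw [h4, ← Real.rpow_natCast, ← Real.rpow_mul h2]
    norm_num
  have hb : b ^ 2 = ∫ x, ‖fderiv ℝ f x‖ ^ 2 := by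
    have h1 := hfd.eLpNorm_eq_integral_rpow_norm (by norm_num) (by norm_num)
    have h2 : 0 ≤ ∫ x, ‖fderiv ℝ f x‖ ^ 2 := integral_nonneg fun x => by positivity
    simp only [ENNReal.toReal_ofNat, Real.rpow_ofNat] at h1
    have h4 : b = (∫ x, ‖fderiv ℝ f x‖ ^ 2) ^ (2 : ℝ)⁻¹ := by
      simp only [b]
      rw [h1, ENNReal.toReal_ofReal (by positivity)]
    rw [h4, ← Real.rpow_natCast, ← Real.rpow_mul h2]
    norm_num
  set G := ∑ j, ip (sd j f) (sd j f)
  have hG0 : 0 ≤ G := Finset.sum_nonneg fun j _ => ip_self_nonneg _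
  have hbG : b ^ 2 ≤ 3 * G := by
    have h1 : 3 * G = ∫ x, 3 * ∑ j, fderiv ℝ f x (Pi.single j 1) ^ 2 := by
      rw [integral_const_mul, integral_finsetSum]
      · simp only [G, ip_apply, sd_apply, sq]
      · intro j _
        simpa only [sd_apply, sq] using integrable_mul (sd j f) (sd j f)
    rw [hb, h1]
    refine integral_mono_of_nonneg (.of_forall fun x => by positivity) ?_
      (.of_forall fun x => norm_sq_le_sum_single _)
    refine (integrable_finsetSum _ fun j _ => ?_).const_mul 3
    simpa only [sd_apply, sq] using integrable_mul (sd j f) (sd j f)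
  have hC0 : (0 : ℝ) ≤ C := C.2
  have ha0 : 0 ≤ a := ENNReal.toReal_nonneg
  have h2 : a ^ 2 ≤ (2 * ((C : ℝ) + 1)) ^ 2 * G := by
    calc a ^ 2 ≤ (C * b) ^ 2 := pow_le_pow_left₀ ha0 h 2
      _ = (C : ℝ) ^ 2 * b ^ 2 := by ring
      _ ≤ (C : ℝ) ^ 2 * (3 * G) := by gcongr
      _ ≤ _ := by nlinarith [mul_nonneg hC0 hG0, mul_nonneg (sq_nonneg (C : ℝ)) hG0]
  rw [ha]
  calc a ^ 6 = (a ^ 2) ^ 3 := by ring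
    _ ≤ ((2 * ((C : ℝ) + 1)) ^ 2 * G) ^ 3 := by gcongr
    _ = _ := by ring

/-- Bound on the production term by the `H¹_α` energies. -/
theorem exists_abs_prodTerm_le : ∃ K : ℝ, 0 < K ∧ ∀ (α : ℝ), 0 < α →
    ∀ w a : Fin 3 → 𝓢(V3, ℝ), |prodTerm w a|
      ≤ K / α ^ ((5 : ℝ) / 2) * √(∑ i, hip α (a i) (a i)) * ∑ i, hip α (w i) (w i) := by
  obtain ⟨κ, hκ, hsob⟩ := exists_integral_pow_six_le
  refine ⟨9 * √(κ ^ 3), by positivity, fun α hα w a => ?_⟩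
  set e := ∑ i, hip α (w i) (w i)
  set A := ∑ i, hip α (a i) (a i)
  have he0 : 0 ≤ e := Finset.sum_nonneg fun i _ => hip_self_nonneg α _
  have hA0 : 0 ≤ A := Finset.sum_nonneg fun i _ => hip_self_nonneg α _
  have hgrad : ∀ g : 𝓢(V3, ℝ), ∑ j, ip (sd j g) (sd j g) ≤ hip α g g / α ^ 2 := fun g => by
    rw [le_div_iff₀ (by positivity), hip]
    have := ip_self_nonneg g
    linarith
  have hle : ∀ (b : Fin 3 → 𝓢(V3, ℝ)) i, hip α (b i) (b i) ≤ ∑ i, hip α (b i) (b i) := fun b i =>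
    Finset.single_le_sum (f := fun i => hip α (b i) (b i))
      (fun i _ => hip_self_nonneg α _) (Finset.mem_univ i)
  have h4 : ∀ i, ip (pmul (w i) (w i)) (pmul (w i) (w i)) ≤ κ ^ 3 * e ^ 2 / α ^ 3 := fun i => by
    have h1 := ip_sq_le (w i) (pmul (w i) (pmul (w i) (w i)))
    have h2 : ip (pmul (w i) (pmul (w i) (w i))) (pmul (w i) (pmul (w i) (w i)))
        = ∫ x, w i x ^ 6 :=
      integral_congr_ae (.of_forall fun x => by simp only [pmul_apply]; ring)
    have h3 : ip (w i) (pmul (w i) (pmul (w i) (w i))) = ip (pmul (w i) (w i)) (pmul (w i) (w i)) :=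
      integral_congr_ae (.of_forall fun x => by simp only [pmul_apply]; ring)
    have h5 : ip (w i) (w i) ≤ e := by
      refine le_trans ?_ (hle w i)
      rw [hip]
      have := mul_nonneg (sq_nonneg α)
        (Finset.sum_nonneg fun j (_ : j ∈ Finset.univ) => ip_self_nonneg (sd j (w i)))
      linarith
    have h6 : ∑ j, ip (sd j (w i)) (sd j (w i)) ≤ e / α ^ 2 :=
      (hgrad (w i)).trans (by gcongr; exact hle w i)
    have h7 : 0 ≤ ∑ j, ip (sd j (w i)) (sd j (w i)) := Finset.sum_nonneg fun j _ => ip_self_nonneg _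
    rw [h2, h3] at h1
    refine le_of_sq_le_sq ?_ (by positivity)
    calc _ ≤ ip (w i) (w i) * ∫ x, w i x ^ 6 := h1
      _ ≤ e * (κ ^ 6 * (e / α ^ 2) ^ 3) := by
        refine mul_le_mul h5 ((hsob (w i)).trans (by gcongr)) ?_ he0
        exact integral_nonneg fun x => by positivity
      _ = _ := by field_simp
  have hterm : ∀ i j, |ip (pmul (w j) (sd j (a i))) (w i)|
      ≤ √(κ ^ 3) / α ^ ((5 : ℝ) / 2) * √A * e := fun i j => by
    have h1 : ip (pmul (w j) (sd j (a i))) (w i) = ip (sd j (a i)) (pmul (w j) (w i)) :=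
      integral_congr_ae (.of_forall fun x => by simp only [pmul_apply]; ring)
    have h2 : ip (pmul (w j) (w i)) (pmul (w j) (w i)) ≤ κ ^ 3 * e ^ 2 / α ^ 3 := by
      have h3 := ip_self_nonneg (pmul (w j) (w j) - pmul (w i) (w i))
      have h5 : ip (pmul (w j) (w j)) (pmul (w i) (w i)) = ip (pmul (w j) (w i)) (pmul (w j) (w i)) :=
        integral_congr_ae (.of_forall fun x => by simp only [pmul_apply]; ring)
      simp only [map_sub, LinearMap.sub_apply, ip_comm (pmul (w i) (w i)) (pmul (w j) (w j)),
        h5] at h3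
      linarith [h4 i, h4 j]
    have h6 : ip (sd j (a i)) (sd j (a i)) ≤ A / α ^ 2 := by
      refine le_trans ?_ ((hgrad (a i)).trans (by gcongr; exact hle a i))
      exact Finset.single_le_sum (f := fun j => ip (sd j (a i)) (sd j (a i)))
        (fun j _ => ip_self_nonneg _) (Finset.mem_univ j)
    have h7 : (α ^ ((5 : ℝ) / 2)) ^ 2 = α ^ 5 := by
      rw [← Real.rpow_natCast, ← Real.rpow_mul hα.le, ← Real.rpow_natCast]
      norm_num
    rw [h1]
    refine abs_le_of_sq_le_sq ?_ (by positivity)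
    refine (ip_sq_le _ _).trans ?_
    calc _ ≤ (A / α ^ 2) * (κ ^ 3 * e ^ 2 / α ^ 3) :=
          mul_le_mul h6 h2 (ip_self_nonneg _) (by positivity)
      _ = _ := by
        rw [mul_pow, mul_pow, div_pow, Real.sq_sqrt (by positivity), Real.sq_sqrt hA0, h7]
        field_simp
  calc |prodTerm w a| ≤ ∑ i : Fin 3, ∑ j : Fin 3, √(κ ^ 3) / α ^ ((5 : ℝ) / 2) * √A * e :=
        (Finset.abs_sum_le_sum_abs _ _).trans (Finset.sum_le_sum fun i _ =>
          (Finset.abs_sum_le_sum_abs _ _).trans (Finset.sum_le_sum fun j _ => hterm i j))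
    _ = _ := by
      simp only [Finset.sum_const, Finset.card_univ, Fintype.card_fin, nsmul_eq_mul]
      push_cast
      ring
/-- A time-dependent Schwartz function all of whose seminorms are bounded on compact time
intervals in `[0, ∞)`. -/
def TimeBdd {F : Type*} [NormedAddCommGroup F] [NormedSpace ℝ F] (G : ℝ → 𝓢(V3, F)) : Prop :=
  ∀ T, Bornology.IsVonNBounded ℝ (G '' Icc 0 T)

section TimeBdd

variable {F F' : Type*} [NormedAddCommGroup F] [NormedSpace ℝ F]
  [NormedAddCommGroup F'] [NormedSpace ℝ F']

theorem TimeBdd.map {G : ℝ → 𝓢(V3, F)} (hG : TimeBdd G) (L : 𝓢(V3, F) →L[ℝ] 𝓢(V3, F')) :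
    TimeBdd fun t => L (G t) := fun T => by
  have := (hG T).image L
  rwa [image_image] at this

theorem TimeBdd.add {G H : ℝ → 𝓢(V3, F)} (hG : TimeBdd G) (hH : TimeBdd H) :
    TimeBdd fun t => G t + H t := fun T => by
  refine ((hG T).add (hH T)).subset ?_
  rintro _ ⟨t, ht, rfl⟩
  exact add_mem_add (mem_image_of_mem _ ht) (mem_image_of_mem _ ht)

theorem TimeBdd.sub {G H : ℝ → 𝓢(V3, F)} (hG : TimeBdd G) (hH : TimeBdd H) :
    TimeBdd fun t => G t - H t := by
  simpa [sub_eq_add_neg] using hG.add (hH.map (-ContinuousLinearMap.id ℝ _))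

theorem TimeBdd.const_smul {G : ℝ → 𝓢(V3, F)} (hG : TimeBdd G) (c : ℝ) :
    TimeBdd fun t => c • G t := by
  let L : 𝓢(V3, F) →L[ℝ] 𝓢(V3, F) := c • ContinuousLinearMap.id ℝ 𝓢(V3, F)
  have hL : ∀ g, L g = c • g := fun g => rfl
  simpa only [hL] using hG.map L

theorem timeBdd_const (g : 𝓢(V3, F)) : TimeBdd fun _ => g := fun T =>
  (Bornology.isVonNBounded_singleton g).subset (by rintro _ ⟨_, _, rfl⟩; rfl)

theorem TimeBdd.exists_decay {G : ℝ → 𝓢(V3, F)} (hG : TimeBdd G) (T : ℝ) :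
    ∃ C : ℝ, 0 ≤ C ∧ ∀ t ∈ Icc 0 T, ∀ x, ‖G t x‖ ≤ C * (1 + ‖x‖) ^ (-4 : ℝ) := by
  obtain ⟨r, hr, h⟩ :=
    ((schwartz_withSeminorms ℝ V3 F).isVonNBounded_iff_finset_seminorm_bounded.1 (hG T))
      (Finset.Iic (4, 0))
  refine ⟨2 ^ 4 * r, by positivity, fun t ht x => ?_⟩
  have h1 := one_add_le_sup_seminorm_apply (𝕜 := ℝ) (m := (4, 0)) (k := 4) (n := 0)
    le_rfl le_rfl (G t) x
  have h2 := (h _ (mem_image_of_mem _ ht)).le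
  have h3 : 0 < 1 + ‖x‖ := by positivity
  rw [norm_iteratedFDeriv_zero] at h1
  rw [Real.rpow_neg h3.le, ← div_eq_mul_inv, le_div_iff₀ (by positivity), mul_comm,
    show (4 : ℝ) = (4 : ℕ) by norm_num, Real.rpow_natCast]
  exact h1.trans (mul_le_mul_of_nonneg_left h2 (by positivity))

theorem SchwartzLocBdd.exists_schwartzMap {g : ℝ → V3 → F} (hg : SchwartzLocBdd g) :
    ∃ G : ℝ → 𝓢(V3, F), (∀ t ≥ 0, ∀ x, G t x = g t x) ∧ TimeBdd G := by
  have hsm : ∀ t ≥ 0, ContDiff ℝ (⊤ : ℕ∞) (g t) := fun t ht => by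
    rw [← contDiffOn_univ]
    exact hg.1.comp (f := fun x : V3 => (t, x)) (by fun_prop) fun x _ => ⟨ht, mem_univ x⟩
  have hmax : ∀ t : ℝ, 0 ≤ max t 0 := fun t => le_max_right _ _
  let G : ℝ → 𝓢(V3, F) := fun t =>
    { toFun := g (max t 0)
      smooth' := hsm _ (hmax t)
      decay' := fun k n => by
        obtain ⟨C, hC⟩ := hg.2 (max t 0 + 1) (by have := hmax t; linarith) k n
        exact ⟨C, hC _ ⟨hmax t, by linarith⟩⟩ }
  have hG : ∀ t ≥ 0, ∀ x, G t x = g t x := fun t ht x => by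
    change g (max t 0) x = g t x
    rw [max_eq_left ht]
  refine ⟨G, hG, fun T => ?_⟩
  rw [(schwartz_withSeminorms ℝ V3 F).isVonNBounded_iff_seminorm_bounded]
  rintro ⟨k, n⟩
  obtain ⟨C, hC⟩ := hg.2 (max T 0 + 1) (by have := hmax T; linarith) k n
  refine ⟨max C 0 + 1, by positivity, ?_⟩
  rintro _ ⟨t, ht, rfl⟩
  refine lt_of_le_of_lt (seminorm_le_bound ℝ k n (G t) (le_max_right C 0) fun x => ?_)
    (lt_add_one _)
  have h1 : (⇑(G t) : V3 → F) = g t := funext (hG t ht.1)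
  rw [h1]
  exact (hC t ⟨ht.1, by linarith [ht.2, le_max_left T 0]⟩ x).trans (le_max_left _ _)

end TimeBdd

/-- Joint smoothness on `[0, ∞) × ℝ³`. -/
def JointSmooth (H : ℝ → V3 → ℝ) : Prop :=
  ContDiffOn ℝ (⊤ : ℕ∞) (fun q : ℝ × V3 => H q.1 q.2) (Ici (0 : ℝ) ×ˢ univ)

theorem JointSmooth.fderiv_apply {H : ℝ → V3 → ℝ} (hH : JointSmooth H) (v : V3) :
    JointSmooth fun t x => fderiv ℝ (H t) x v := by
  have hu : UniqueDiffOn ℝ (Ici (0 : ℝ) ×ˢ (univ : Set V3)) :=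
    (uniqueDiffOn_Ici 0).prod uniqueDiffOn_univ
  have h1 := (hH.fderivWithin hu (m := (⊤ : ℕ∞)) (by simp)).clm_apply
    (contDiffOn_const (c := ((0 : ℝ), v)))
  refine h1.congr fun q hq => ?_
  have h2 := (hH.differentiableOn (by simp) q hq).hasFDerivWithinAt
  have h3 : HasFDerivAt (fun y : V3 => (q.1, y)) (ContinuousLinearMap.inr ℝ ℝ V3) q.2 :=
    hasFDerivAt_prodMk_right q.1 q.2
  have h4 := h2.comp (s := univ) q.2 h3.hasFDerivWithinAt fun y _ => mk_mem_prod hq.1 (mem_univ y)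
  rw [hasFDerivWithinAt_univ] at h4
  have h5 : HasFDerivAt (H q.1) _ q.2 := h4
  simp [h5.fderiv]

theorem JointSmooth.continuousOn {H : ℝ → V3 → ℝ} (hH : JointSmooth H) (x : V3) :
    ContinuousOn (fun t => H t x) (Ici 0) := by
  have h : ContinuousOn (fun q : ℝ × V3 => H q.1 q.2) (Ici (0 : ℝ) ×ˢ univ) :=
    ContDiffOn.continuousOn hH
  refine h.comp (f := fun t : ℝ => (t, x)) (Continuous.continuousOn (by fun_prop)) fun t ht => ?_
  exact mk_mem_prod ht (mem_univ x)

theorem hasDerivWithinAt_hip (α : ℝ) {G D : ℝ → 𝓢(V3, ℝ)} (hG : TimeBdd G) (hD : TimeBdd D)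
    (hGs : JointSmooth fun t x => G t x)
    (hd : ∀ t ≥ 0, ∀ x, HasDerivWithinAt (fun s => G s x) (D t x) (Ici 0) t) {t : ℝ}
    (ht : 0 ≤ t) :
    HasDerivWithinAt (fun s => hip α (G s) (G s)) (2 * ip (D t) (helm α (G t))) (Ici 0) t := by
  rw [hasDerivWithinAt_iff_tendsto_slope]
  have hslope : ∀ s, slope (fun s => hip α (G s) (G s)) t s
      = ∫ x, slope (fun s => G s x) t s * (helm α (G s) x + helm α (G t) x) := fun s => by
    have h1 : slope (fun s => hip α (G s) (G s)) t s
        = ip ((s - t)⁻¹ • (G s - G t)) (helm α (G s) + helm α (G t)) := by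
      simp only [slope_def_field, map_sub, map_add, map_smul, LinearMap.sub_apply,
        LinearMap.smul_apply, ip_helm, smul_eq_mul, hip_comm α (G t) (G s)]
      ring
    rw [h1, ip_apply]
    exact integral_congr_ae (.of_forall fun x => by simp [slope_def_field, div_eq_inv_mul])
  simp only [funext hslope]
  have hlim : 2 * ip (D t) (helm α (G t)) = ∫ x, D t x * (helm α (G t) x + helm α (G t) x) := by
    rw [ip_apply, ← integral_const_mul]
    exact integral_congr_ae (.of_forall fun x => by simp only; ring)
  rw [hlim]
  obtain ⟨C₁, hC₁, h₁⟩ := hD.exists_decay (t + 1)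
  obtain ⟨C₂, hC₂, h₂⟩ := (hG.map (helm α)).exists_decay (t + 1)
  have hev : ∀ᶠ s in 𝓝[Ici 0 \ {t}] t, s ∈ Icc 0 (t + 1) := by
    filter_upwards [self_mem_nhdsWithin, mem_nhdsWithin_of_mem_nhds (Iio_mem_nhds (lt_add_one t))]
      with s hs hs' using ⟨hs.1, le_of_lt hs'⟩
  have htm : t ∈ Icc 0 (t + 1) := ⟨ht, by linarith⟩
  have hdecay : ∀ x : V3, (1 + ‖x‖) ^ (-4 : ℝ) ≤ 1 := fun x =>
    Real.rpow_le_one_of_one_le_of_nonpos (by linarith [norm_nonneg x]) (by norm_num)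
  refine tendsto_integral_filter_of_dominated_convergence
    (fun x => C₁ * (1 + ‖x‖) ^ (-4 : ℝ) * (C₂ + C₂)) ?_ ?_ ?_ ?_
  · refine .of_forall fun s => Continuous.aestronglyMeasurable ?_
    simp only [slope_def_field]
    exact (((G s).continuous.sub (G t).continuous).div_const _).mul
      ((helm α (G s)).continuous.add (helm α (G t)).continuous)
  · filter_upwards [hev] with s hs
    refine .of_forall fun x => ?_
    have h3 : ∀ r ∈ Icc 0 (t + 1), ‖helm α (G r) x‖ ≤ C₂ := fun r hr =>
      (h₂ r hr x).trans (mul_le_of_le_one_right hC₂ (hdecay x))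
    have h4 : ‖slope (fun s => G s x) t s‖ ≤ C₁ * (1 + ‖x‖) ^ (-4 : ℝ) := by
      have h5 := (convex_Icc 0 (t + 1)).norm_image_sub_le_of_norm_hasDerivWithin_le
        (fun r hr => (hd r hr.1 x).mono Icc_subset_Ici_self) (fun r hr => h₁ r hr x) htm hs
      rw [slope_def_field, norm_div]
      exact div_le_of_le_mul₀ (norm_nonneg _) (by positivity) h5
    rw [norm_mul]
    exact mul_le_mul h4 ((norm_add_le _ _).trans (add_le_add (h3 s hs) (h3 t htm)))
      (norm_nonneg _) (by positivity)
  · refine (Integrable.const_mul ?_ _).mul_const _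
    exact integrable_one_add_norm (by simp; norm_num)
  · refine .of_forall fun x => ?_
    have h3 := hasDerivWithinAt_iff_tendsto_slope.1 (hd t ht x)
    have h4 : ContinuousOn (fun s => helm α (G s) x) (Ici 0) := by
      have h5 : ∀ j, ContinuousOn (fun s => sd j (sd j (G s)) x) (Ici 0) := fun j =>
        ((hGs.fderiv_apply (Pi.single j 1)).fderiv_apply (Pi.single j 1)).continuousOn x
      have h6 : ∀ s, helm α (G s) x = G s x - α ^ 2 * ∑ j, sd j (sd j (G s)) x := fun s => by
        simp [helm_apply]
      simp only [h6]
      exact (hGs.continuousOn x).sub (continuousOn_const.mul (continuousOn_finsetSum _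
        fun j _ => h5 j))
    exact h3.mul (((h4 t ht).mono sdiff_subset).add tendsto_const_nhds)

theorem le_of_deriv_le_affine {E E' : ℝ → ℝ} {η C : ℝ}
    (hE : ∀ t ≥ 0, HasDerivWithinAt E (E' t) (Ici 0) t)
    (h : ∀ t ≥ 0, E' t ≤ η * E t + C) {t : ℝ} (ht : 0 ≤ t) :
    E t ≤ E 0 * Real.exp (η * t) + C * ∫ s in (0 : ℝ)..t, Real.exp (η * (t - s)) := by
  let g : ℝ → ℝ := fun t => E t * Real.exp (-η * t) - C * ∫ s in (0 : ℝ)..t, Real.exp (-η * s)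
  have hcont : Continuous fun s : ℝ => Real.exp (-η * s) := by fun_prop
  have hg : ∀ t ≥ 0, HasDerivWithinAt g
      ((E' t - η * E t - C) * Real.exp (-η * t)) (Ici 0) t := fun t ht => by
    have h1 : HasDerivAt (fun t : ℝ => Real.exp (-η * t)) (Real.exp (-η * t) * -η) t := by
      simpa using ((hasDerivAt_id t).const_mul (-η)).exp
    have h2 : HasDerivAt (fun t => ∫ s in (0 : ℝ)..t, Real.exp (-η * s)) (Real.exp (-η * t)) t :=
      intervalIntegral.integral_hasDerivAt_right (hcont.intervalIntegrable _ _)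
        (hcont.stronglyMeasurableAtFilter _ _) hcont.continuousAt
    convert! ((hE t ht).mul h1.hasDerivWithinAt).sub (h2.const_mul C).hasDerivWithinAt using 1
    ring
  have hanti : AntitoneOn g (Ici 0) := by
    refine antitoneOn_of_hasDerivWithinAt_nonpos (convex_Ici 0)
      (f' := fun t => (E' t - η * E t - C) * Real.exp (-η * t))
      (fun t ht => (hg t ht).continuousWithinAt) (fun t ht => ?_) (fun t ht => ?_)
    · exact (hg t (interior_subset ht)).mono interior_subset
    · have := h t (interior_subset ht)
      exact mul_nonpos_of_nonpos_of_nonneg (by linarith) (Real.exp_pos _).le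
  have h1 := hanti self_mem_Ici ht ht
  have h2 : ∫ s in (0 : ℝ)..t, Real.exp (η * (t - s))
      = Real.exp (η * t) * ∫ s in (0 : ℝ)..t, Real.exp (-η * s) := by
    rw [← intervalIntegral.integral_const_mul]
    refine intervalIntegral.integral_congr fun s _ => ?_
    simp only [← Real.exp_add]
    ring_nf
  simp only [g, mul_zero, Real.exp_zero, mul_one, intervalIntegral.integral_same, sub_zero] at h1
  have h3 := mul_le_mul_of_nonneg_right h1 (Real.exp_pos (η * t)).le
  have h4 : Real.exp (-η * t) * Real.exp (η * t) = 1 := by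
    rw [← Real.exp_add]
    simp
  rw [h2]
  linear_combination h3 - E t * h4

/-- A classical solution with its components bundled as Schwartz functions. -/
structure SchwartzSolution (α β ν : ℝ) (F : Fin 3 → 𝓢(V3, ℝ)) where
  u : ℝ → Fin 3 → 𝓢(V3, ℝ)
  N : ℝ → Fin 3 → 𝓢(V3, ℝ)
  p : ℝ → 𝓢(V3, ℝ)
  bdd_u : ∀ i, TimeBdd fun t => u t i
  bdd_N : ∀ i, TimeBdd fun t => N t i
  bdd_p : TimeBdd p
  smooth_u : ∀ i, JointSmooth fun t x => u t i x
  divFree : ∀ t ≥ 0, ∑ j, sd j (u t j) = 0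
  filter : ∀ t ≥ 0, ∀ i, helm α (N t i) = ∑ j, pmul (u t j) (sd j (u t i))
  momentum : ∀ t ≥ 0, ∀ i x, HasDerivWithinAt (fun s => u s i x)
    ((F i - β • u t i - N t i + ν • (∑ j, sd j (sd j (u t i))) - sd i (p t)) x) (Ici 0) t

/-- The rest state. -/
def SchwartzSolution.zero (α β ν : ℝ) : SchwartzSolution α β ν 0 where
  u := 0
  N := 0
  p := 0
  bdd_u _ := timeBdd_const 0
  bdd_N _ := timeBdd_const 0
  bdd_p := timeBdd_const 0
  smooth_u _ := contDiffOn_const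
  divFree := by simp
  filter t _ i := by ext x; simp [pmul_apply]
  momentum t _ i x := by simpa using hasDerivWithinAt_const t (Ici 0) (0 : ℝ)

section

variable {α β ν : ℝ}

theorem SchwartzSolution.energy_diff_le {F₁ F₂ : Fin 3 → 𝓢(V3, ℝ)} (hβ : 0 < β) (hν : 0 < ν)
    (S₁ : SchwartzSolution α β ν F₁) (S₂ : SchwartzSolution α β ν F₂) (K : ℝ)
    (hK : ∀ t ≥ 0, -2 * prodTerm (S₁.u t - S₂.u t) (S₁.u t)
      ≤ K * ∑ i, hip α ((S₁.u t - S₂.u t) i) ((S₁.u t - S₂.u t) i)) {t : ℝ} (ht : 0 ≤ t) :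
    ∑ i, hip α ((S₁.u t - S₂.u t) i) ((S₁.u t - S₂.u t) i)
      ≤ (∑ i, hip α ((S₁.u 0 - S₂.u 0) i) ((S₁.u 0 - S₂.u 0) i)) * Real.exp ((-β + K) * t)
        + 1 / β * (∑ i, hip α ((F₁ - F₂) i) ((F₁ - F₂) i))
          * ∫ s in (0 : ℝ)..t, Real.exp ((-β + K) * (t - s)) := by
  let d : ℝ → Fin 3 → 𝓢(V3, ℝ) := fun t i =>
    (F₁ - F₂) i - β • (S₁.u t - S₂.u t) i - (S₁.N t - S₂.N t) i
      + ν • (∑ j, sd j (sd j ((S₁.u t - S₂.u t) i))) - sd i (S₁.p t - S₂.p t)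
  have hw : ∀ i, TimeBdd fun t => (S₁.u t - S₂.u t) i := fun i => (S₁.bdd_u i).sub (S₂.bdd_u i)
  have hdb : ∀ i, TimeBdd fun t => d t i := fun i => by
    refine TimeBdd.sub (TimeBdd.add (TimeBdd.sub (TimeBdd.sub (timeBdd_const _)
      ((hw i).const_smul β)) ((S₁.bdd_N i).sub (S₂.bdd_N i))) ?_)
      ((S₁.bdd_p.sub S₂.bdd_p).map (sd i))
    have := ((hw i).map (∑ j, (sd j).comp (sd j))).const_smul ν
    simpa using this
  have hdd : ∀ i, ∀ t ≥ 0, ∀ x,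
      HasDerivWithinAt (fun s => (S₁.u s - S₂.u s) i x) (d t i x) (Ici 0) t := fun i t ht x => by
    convert! (S₁.momentum t ht i x).sub (S₂.momentum t ht i x) using 1
    simp only [d, Pi.sub_apply, map_sub, Finset.sum_sub_distrib, sub_apply,
      add_apply, smul_apply, smul_eq_mul]
    ring
  refine le_of_deriv_le_affine (fun t ht => HasDerivWithinAt.fun_sum fun i _ =>
    hasDerivWithinAt_hip α (hw i) (hdb i) ((S₁.smooth_u i).sub (S₂.smooth_u i)) (hdd i) ht)
    (fun t ht => ?_) ht
  rw [← Finset.mul_sum]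
  have h1 := energy_balance_le (α := α) hβ hν (S₁.u t - S₂.u t) (S₁.N t - S₂.N t) (F₁ - F₂)
    (S₁.u t) (S₂.u t) (d t) (S₁.p t - S₂.p t)
    (by simp only [Pi.sub_apply, map_sub, Finset.sum_sub_distrib, S₁.divFree t ht, S₂.divFree t ht,
          sub_zero])
    (S₂.divFree t ht) (fun i => ?_) (fun i => rfl)
  · linarith [hK t ht]
  · rw [Pi.sub_apply, map_sub, S₁.filter t ht, S₂.filter t ht, ← Finset.sum_sub_distrib]
    refine Finset.sum_congr rfl fun j _ => ?_
    ext x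
    simp only [Pi.sub_apply, map_sub, sub_apply, add_apply, pmul_apply]
    ring

theorem SchwartzSolution.energy_le {F : Fin 3 → 𝓢(V3, ℝ)} (hβ : 0 < β) (hν : 0 < ν)
    (S : SchwartzSolution α β ν F) {B : ℝ} (h0 : ∑ i, hip α (S.u 0 i) (S.u 0 i) ≤ B)
    (hF : ∑ i, hip α (F i) (F i) ≤ β ^ 2 * B) {t : ℝ} (ht : 0 ≤ t) :
    ∑ i, hip α (S.u t i) (S.u t i) ≤ B := by
  have hneg : ∀ g : 𝓢(V3, ℝ), hip α (0 - g) (0 - g) = hip α g g := fun g => by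
    simp [hip]
  have h := SchwartzSolution.energy_diff_le hβ hν (SchwartzSolution.zero α β ν) S 0
    (fun t _ => by simp [prodTerm, SchwartzSolution.zero, pmul]) ht
  simp only [SchwartzSolution.zero, Pi.sub_apply, Pi.zero_apply, hneg, add_zero] at h
  have hint : ∫ s in (0 : ℝ)..t, Real.exp (-β * (t - s)) = (1 - Real.exp (-β * t)) / β := by
    have hd : ∀ s ∈ uIcc 0 t, HasDerivAt (fun s => Real.exp (-β * (t - s)) / β)
        (Real.exp (-β * (t - s))) s := fun s _ => by
      have := ((((hasDerivAt_id s).const_sub t).const_mul (-β)).exp).div_const β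
      convert! this using 1
      simp only [id]
      field_simp
    rw [intervalIntegral.integral_eq_sub_of_hasDerivAt hd
      (Continuous.intervalIntegrable (by fun_prop) _ _)]
    simp [sub_div]
  rw [hint] at h
  have he : Real.exp (-β * t) ≤ 1 := Real.exp_le_one_iff.2 (by nlinarith)
  calc _ ≤ _ := h
    _ ≤ B * Real.exp (-β * t) + 1 / β * (β ^ 2 * B) * ((1 - Real.exp (-β * t)) / β) := by
      have : 0 ≤ (1 - Real.exp (-β * t)) / β := div_nonneg (by linarith) hβ.le
      gcongr
    _ = B := by field_simp; ring

theorem pd_apply (j : Fin 3) {g : V3 → Fin 3 → ℝ} {V : Fin 3 → 𝓢(V3, ℝ)}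
    (h : ∀ x i, V i x = g x i) (x : V3) (i : Fin 3) : sd j (V i) x = pd j g x i := by
  have hg : g = fun x i => V i x := funext fun x => funext fun i => (h x i).symm
  rw [pd, hg, fderiv_pi fun i => (V i).differentiableAt]
  rfl

theorem H1aSq_eq (α : ℝ) {g : V3 → Fin 3 → ℝ} {V : Fin 3 → 𝓢(V3, ℝ)}
    (h : ∀ x i, V i x = g x i) : H1aSq α g = ∑ i, hip α (V i) (V i) := by
  simp only [H1aSq, L2sq, H1sq, ← h, ← pd_apply _ h, hip, ip_apply, Finset.sum_add_distrib,
    ← Finset.mul_sum, sq]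
  rw [integral_finsetSum _ fun i _ => integrable_mul _ _,
    integral_finsetSum _ fun i _ => integrable_finsetSum _ fun j _ => integrable_mul _ _]
  simp only [integral_finsetSum _ fun j _ => integrable_mul (sd j _) (sd j _)]

theorem IsForce.exists_schwartzMap {f : V3 → Fin 3 → ℝ} (hf : IsForce f) :
    ∃ F : Fin 3 → 𝓢(V3, ℝ), ∀ x i, F i x = f x i :=
  ⟨fun i => postcompCLM (𝕜 := ℝ) (ContinuousLinearMap.proj (R := ℝ) i)
    (⟨f, hf.1.1, hf.1.2⟩ : 𝓢(V3, Fin 3 → ℝ)), fun _ _ => rfl⟩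

theorem ClassicalSolution.exists_schwartzSolution {u₀ f : V3 → Fin 3 → ℝ}
    (sol : ClassicalSolution α β ν u₀ f) {F : Fin 3 → 𝓢(V3, ℝ)} (hF : ∀ x i, F i x = f x i) :
    ∃ S : SchwartzSolution α β ν F, ∀ t ≥ 0, ∀ x i, S.u t i x = sol.u t x i := by
  obtain ⟨U, hU, bU⟩ := sol.reg_u.exists_schwartzMap
  obtain ⟨N, hN, bN⟩ := sol.reg_N.exists_schwartzMap
  obtain ⟨P, hP, bP⟩ := sol.reg_p.exists_schwartzMap
  let c : Fin 3 → 𝓢(V3, Fin 3 → ℝ) →L[ℝ] 𝓢(V3, ℝ) := fun i =>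
    postcompCLM (ContinuousLinearMap.proj (R := ℝ) i)
  have hu : ∀ t ≥ 0, ∀ x i, c i (U t) x = sol.u t x i := fun t ht x i =>
    congrFun (hU t ht x) i
  have hn : ∀ t ≥ 0, ∀ x i, c i (N t) x = sol.N t x i := fun t ht x i =>
    congrFun (hN t ht x) i
  have hlap : ∀ {g : V3 → Fin 3 → ℝ} {V : Fin 3 → 𝓢(V3, ℝ)} (_ : ∀ x i, V i x = g x i) j x i,
      sd j (sd j (V i)) x = pd j (pd j g) x i := fun h j x i =>
    pd_apply (V := fun i => sd j _) j (pd_apply j h) x i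
  have hsm : ∀ i, JointSmooth fun t x => sol.u t x i := fun i =>
    (ContinuousLinearMap.proj (R := ℝ) (φ := fun _ : Fin 3 => ℝ) i).contDiff.comp_contDiffOn
      sol.reg_u.1
  refine ⟨⟨fun t i => c i (U t), fun t i => c i (N t), P, fun i => bU.map (c i),
    fun i => bN.map (c i), bP, fun i => (hsm i).congr fun q hq => hu q.1 hq.1 q.2 i,
    fun t ht => ?_, fun t ht i => ?_, fun t ht i x => ?_⟩, hu⟩
  · ext x
    simpa [← pd_apply _ (hu t ht)] using sol.divFree t ht x
  · ext x
    have := sol.filter t ht x i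
    simp only [← hlap (hn t ht), ← hn t ht, ← pd_apply _ (hu t ht), ← hu t ht] at this
    simp only [helm_apply, sub_apply, smul_apply, sum_apply,
      smul_eq_mul, pmul_apply, ← this]
    ring
  · have hdiff : DifferentiableWithinAt ℝ (fun s => sol.u s x i) (Ici 0) t :=
      ((hsm i).differentiableOn (by simp) (t, x) ⟨ht, mem_univ x⟩).comp (f := fun s : ℝ => (s, x)) t
        (by fun_prop) fun s hs => ⟨hs, mem_univ x⟩
    have h1 := hdiff.hasDerivWithinAt
    have h2 := sol.momentum t ht x i
    have hp : sd i (P t) x = pdS i (sol.p t) x := by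
      rw [sd_apply, pdS, show (⇑(P t) : V3 → ℝ) = sol.p t from funext (hP t ht)]
    convert! h1.congr (fun s hs => hu s hs x i) (hu t ht x i) using 1
    simp only [sub_apply, add_apply, smul_apply,
      sum_apply, smul_eq_mul, hlap (hu t ht), hn t ht, hu t ht, hp, hF]
    linarith

end

/-- Long-time comparison estimate for two solutions with possibly different data and forces. -/
theorem comparison_estimate :
    ∃ c : ℝ, 0 < c ∧
    ∀ (α β ν : ℝ), 0 < α → 0 < β → 0 < ν →
    ∀ (f₁ f₂ : V3 → Fin 3 → ℝ), IsForce f₁ → IsForce f₂ →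
    ∀ (u₀₁ u₀₂ : V3 → Fin 3 → ℝ)
      (sol₁ : ClassicalSolution α β ν u₀₁ f₁) (sol₂ : ClassicalSolution α β ν u₀₂ f₂),
      Real.sqrt (H1aSq α u₀₁) ≤ Real.sqrt 8 / β * Real.sqrt (H1aSq α f₁) →
      ∀ η : ℝ, η = -β + c / (α ^ ((5:ℝ)/2) * β) * Real.sqrt (H1aSq α f₁) →
      ∀ t ≥ (0:ℝ),
        H1aSq α (fun x i => sol₁.u t x i - sol₂.u t x i)
          ≤ H1aSq α (fun x i => u₀₁ x i - u₀₂ x i) * Real.exp (η * t)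
            + 1 / β * H1aSq α (fun x i => f₁ x i - f₂ x i)
              * (∫ s in (0:ℝ)..t, Real.exp (η * (t - s))) := by
  obtain ⟨K, hK, hprod⟩ := exists_abs_prodTerm_le
  refine ⟨2 * K * √8, by positivity, ?_⟩
  intro α β ν hα hβ hν f₁ f₂ hf₁ hf₂ u₀₁ u₀₂ sol₁ sol₂ hsmall η hη t ht
  obtain ⟨F₁, hF₁⟩ := hf₁.exists_schwartzMap
  obtain ⟨F₂, hF₂⟩ := hf₂.exists_schwartzMap
  obtain ⟨S₁, h₁⟩ := sol₁.exists_schwartzSolution hF₁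
  obtain ⟨S₂, h₂⟩ := sol₂.exists_schwartzSolution hF₂
  have h₁0 : ∀ x i, S₁.u 0 i x = u₀₁ x i := fun x i => by rw [h₁ 0 le_rfl, sol₁.init]
  have h₂0 : ∀ x i, S₂.u 0 i x = u₀₂ x i := fun x i => by rw [h₂ 0 le_rfl, sol₂.init]
  rw [H1aSq_eq α (V := S₁.u t - S₂.u t) fun x i => by simp [h₁ t ht, h₂ t ht],
    H1aSq_eq α (V := S₁.u 0 - S₂.u 0) fun x i => by simp [h₁0, h₂0],
    H1aSq_eq α (V := F₁ - F₂) fun x i => by simp [hF₁, hF₂], hη]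
  rw [H1aSq_eq α h₁0, H1aSq_eq α hF₁] at hsmall
  rw [H1aSq_eq α hF₁]
  set f := ∑ i, hip α (F₁ i) (F₁ i)
  have hf0 : 0 ≤ f := Finset.sum_nonneg fun i _ => hip_self_nonneg α _
  have hbound : ∀ t ≥ 0, ∑ i, hip α (S₁.u t i) (S₁.u t i) ≤ 8 / β ^ 2 * f := fun t ht => by
    refine S₁.energy_le hβ hν ?_ ?_ ht
    · have h := pow_le_pow_left₀ (Real.sqrt_nonneg _) hsmall 2
      rwa [Real.sq_sqrt (Finset.sum_nonneg fun i _ => hip_self_nonneg α _), mul_pow, div_pow,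
        Real.sq_sqrt (by norm_num), Real.sq_sqrt hf0] at h
    · have : β ^ 2 * (8 / β ^ 2 * f) = 8 * f := by field_simp
      linarith
  refine SchwartzSolution.energy_diff_le hβ hν S₁ S₂ _ (fun t ht => ?_) ht
  have hsqrt : √(∑ i, hip α (S₁.u t i) (S₁.u t i)) ≤ √8 / β * √f := by
    refine Real.sqrt_le_iff.2 ⟨by positivity, (hbound t ht).trans (le_of_eq ?_)⟩
    rw [mul_pow, div_pow, Real.sq_sqrt (by norm_num), Real.sq_sqrt hf0]
  have he0 : 0 ≤ ∑ i, hip α ((S₁.u t - S₂.u t) i) ((S₁.u t - S₂.u t) i) :=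
    Finset.sum_nonneg fun i _ => hip_self_nonneg α _
  set e := ∑ i, hip α ((S₁.u t - S₂.u t) i) ((S₁.u t - S₂.u t) i)
  have hp := hprod α hα (S₁.u t - S₂.u t) (S₁.u t)
  calc -2 * prodTerm (S₁.u t - S₂.u t) (S₁.u t)
      ≤ 2 * |prodTerm (S₁.u t - S₂.u t) (S₁.u t)| := by
        linarith [neg_abs_le (prodTerm (S₁.u t - S₂.u t) (S₁.u t))]
    _ ≤ 2 * (K / α ^ ((5 : ℝ) / 2) * (√8 / β * √f) * e) := by
      refine mul_le_mul_of_nonneg_left (hp.trans ?_) zero_le_two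
      gcongr
    _ = _ := by
      have : (0 : ℝ) < α ^ ((5 : ℝ) / 2) := by positivity
      field_simp

end
end
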